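/- arXiv:math/0212114 — 6 statements merged into one kernel-verified Lean document; each statement's English description precedes it below -/
import Mathlib

section
/- Let Γ be a group whose FC-centre K(Γ) equals its centre Z(Γ), and suppose Z(Γ) is torsion free. Then every bounded automorphism of Γ is the identity (equivalently, the natural map from Aut(Γ) to the quasi-isometry group of Γ is injective). -/
/-- The fixed-point subgroup of an automorphism. -/
def fixedSubgroup {Γ : Type*} [Group Γ] (φ : Γ ≃* Γ) : Subgroup Γ where
  carrier := {γ | φ γ = γ}
  one_mem' := map_one φ
  mul_mem' := by intro a b ha hb; simp only [Set.mem_setOf_eq] at *; rw [map_mul, ha, hb]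
  inv_mem' := by intro a ha; simp only [Set.mem_setOf_eq] at *; rw [map_inv, ha]

/-- An automorphism is *bounded* if its fixed-point subgroup has finite index. -/
def IsBoundedAut {Γ : Type*} [Group Γ] (φ : Γ ≃* Γ) : Prop :=
  (fixedSubgroup φ).FiniteIndex

/-- The FC-centre of a group: the subgroup of elements whose centralizer has finite index. -/
def FCCentre (Γ : Type*) [Group Γ] : Subgroup Γ where
  carrier := {γ | (Subgroup.centralizer {γ}).FiniteIndex}
  one_mem' := by
    have h : Subgroup.centralizer ({1} : Set Γ) = ⊤ := by
      ext g; simp [Subgroup.mem_centralizer_iff]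
    simp only [Set.mem_setOf_eq, h]
    infer_instance
  mul_mem' := by
    intro a b ha hb
    simp only [Set.mem_setOf_eq] at *
    have hle : Subgroup.centralizer {a} ⊓ Subgroup.centralizer {b} ≤
        Subgroup.centralizer {a * b} := by
      rintro g ⟨hga, hgb⟩
      rw [Subgroup.mem_centralizer_iff] at *
      intro h hh
      rcases hh with rfl
      have h1 := hga a rfl
      have h2 := hgb b rfl
      calc a * b * g = a * (b * g) := by group
        _ = a * (g * b) := by rw [h2]
        _ = (a * g) * b := by group
        _ = (g * a) * b := by rw [h1]
        _ = g * (a * b) := by group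
    haveI := ha; haveI := hb
    exact Subgroup.finiteIndex_of_le hle
  inv_mem' := by
    intro a ha
    simp only [Set.mem_setOf_eq] at *
    have h : Subgroup.centralizer ({a⁻¹} : Set Γ) = Subgroup.centralizer {a} := by
      ext g
      simp only [Subgroup.mem_centralizer_iff, Set.mem_singleton_iff, forall_eq]
      constructor
      · intro h; have := congrArg (fun x => a * x * a) h
        group at this ⊢; simpa [mul_assoc] using this.symm
      · intro h; have := congrArg (fun x => a⁻¹ * x * a⁻¹) h
        group at this ⊢; simpa [mul_assoc] using this.symm
    rw [h]; exact ha

theorem mem_FCCentre_iff {Γ : Type*} [Group Γ] (γ : Γ) :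
    γ ∈ FCCentre Γ ↔ (Subgroup.centralizer {γ}).FiniteIndex := Iff.rfl

theorem inv_mul_apply_mem_FCCentre {Γ : Type*} [Group Γ] {φ : Γ ≃* Γ} (hφ : IsBoundedAut φ)
    (γ : Γ) : γ⁻¹ * φ γ ∈ FCCentre Γ := by
  rw [mem_FCCentre_iff]
  have : (fixedSubgroup φ).FiniteIndex := hφ
  refine Subgroup.finiteIndex_of_le (H := (fixedSubgroup φ).normalCore) fun n hn => ?_
  have hfix : φ n = n := (fixedSubgroup φ).normalCore_le hn
  have hconj : φ (γ * n * γ⁻¹) = γ * n * γ⁻¹ := hn γ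
  rw [map_mul, map_mul, map_inv, hfix, mul_inv_eq_iff_eq_mul] at hconj
  rw [Subgroup.mem_centralizer_singleton_iff]
  rw [mul_assoc γ⁻¹, hconj]
  group

/-- If the FC-centre of `Γ` equals its centre and the centre is torsion free, then every
bounded automorphism of `Γ` is the identity (equivalently, `Aut(Γ) → QI(Γ)` is injective). -/
theorem bounded_aut_trivial_of_fcCentre_eq_center_torsionFree (Γ : Type*) [Group Γ]
    (heq : FCCentre Γ = Subgroup.center Γ)
    (htf : ∀ γ ∈ Subgroup.center Γ, IsOfFinOrder γ → γ = 1) :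
    ∀ φ : Γ ≃* Γ, IsBoundedAut φ → φ = MulEquiv.refl Γ := by
  intro φ hφ
  have hfin : (fixedSubgroup φ).FiniteIndex := hφ
  ext γ
  have hz : γ⁻¹ * φ γ ∈ Subgroup.center Γ := heq ▸ inv_mul_apply_mem_FCCentre hφ γ
  obtain ⟨k, hk, -, hmem⟩ := Subgroup.exists_pow_mem_of_index_ne_zero hfin.index_ne_zero γ
  have hpow : φ (γ ^ k) = γ ^ k := hmem
  have hcomm : Commute γ (γ⁻¹ * φ γ) := Subgroup.mem_center_iff.mp hz γ
  have hone : (γ⁻¹ * φ γ) ^ k = 1 := by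
    have h := hcomm.mul_pow k
    rw [mul_inv_cancel_left, ← map_pow, hpow] at h
    exact left_eq_mul.mp h
  exact (inv_mul_eq_one.mp (htf _ hz (isOfFinOrder_iff_pow_eq_one.mpr ⟨k, hk, hone⟩))).symm
end

section
/- Let φ be a bounded automorphism of a group Γ, i.e., Fix(φ) = {γ ∈ Γ : φ(γ) = γ} has finite index in Γ. Then for every γ ∈ Γ, the element φ(γ)γ⁻¹ belongs to the FC-centre K(Γ). -/
/-- If `φ` is a bounded automorphism of `Γ`, then `φ(γ)γ⁻¹` lies in the FC-centre of `Γ`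
for every `γ ∈ Γ`. -/
theorem bounded_aut_diff_mem_fcCentre (Γ : Type*) [Group Γ] (φ : Γ ≃* Γ)
    (hφ : IsBoundedAut φ) (γ : Γ) :
    φ γ * γ⁻¹ ∈ FCCentre Γ := by
  have : (fixedSubgroup φ).FiniteIndex := hφ
  rw [mem_FCCentre_iff]
  refine Subgroup.finiteIndex_of_le (H := (fixedSubgroup φ).normalCore) fun h hh => ?_
  have h_fixed : φ h = h := Subgroup.normalCore_le _ hh
  have h_conj : φ (γ⁻¹ * h * γ) = γ⁻¹ * h * γ := by
    have h_mem : γ⁻¹ * h * γ ∈ fixedSubgroup φ := by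
      simpa using Subgroup.normalCore_le _
        ((Subgroup.normalCore_normal (fixedSubgroup φ)).conj_mem h hh γ⁻¹)
    exact h_mem
  rw [map_mul, map_mul, map_inv, h_fixed] at h_conj
  rw [Subgroup.mem_centralizer_singleton_iff]
  calc h * (φ γ * γ⁻¹) = φ γ * ((φ γ)⁻¹ * h * φ γ) * γ⁻¹ := by group
    _ = φ γ * (γ⁻¹ * h * γ) * γ⁻¹ := by rw [h_conj]
    _ = φ γ * γ⁻¹ * h := by group
end

section
/- Let D∞ be the infinite dihedral group ⟨x, y | x² = 1, x y x = y⁻¹⟩ (DihedralGroup 0). The subgroup of Aut(D∞) consisting of bounded automorphisms is infinite cyclic, generated by the automorphism φ determined by φ(x) = xy and φ(y) = y (i.e., φ(r i) = r i and φ(sr i) = sr i · r 1 for all i ∈ ℤ). -/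
open DihedralGroup in
/-- The automorphism `φ` of `D∞ = DihedralGroup 0` with `φ(y) = y` and `φ(x) = xy`,
i.e. `φ(r i) = r i` and `φ(sr i) = sr i * r 1 = sr (i + 1)`. -/
def dihedralShift : MulAut (DihedralGroup 0) where
  toFun g := match g with
    | .r i => .r i
    | .sr i => .sr (i + 1)
  invFun g := match g with
    | .r i => .r i
    | .sr i => .sr (i - 1)
  left_inv g := by
    rcases g with i | i
    · rfl
    · show DihedralGroup.sr (i + 1 - 1) = DihedralGroup.sr i
      congr 1
      ring
  right_inv g := by
    rcases g with i | i
    · rfl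
    · show DihedralGroup.sr (i - 1 + 1) = DihedralGroup.sr i
      congr 1
      ring
  map_mul' a b := by
    rcases a with i | i <;> rcases b with j | j <;>
      simp only [r_mul_r, r_mul_sr, sr_mul_r, sr_mul_sr] <;> congr 1 <;> ring

theorem mem_fixedSubgroup {Γ : Type*} [Group Γ] {φ : Γ ≃* Γ} {γ : Γ} :
    γ ∈ fixedSubgroup φ ↔ φ γ = γ := Iff.rfl

theorem DihedralGroup.r_mem_zpowers_r_one {n : ℕ} (i : ZMod n) :
    r i ∈ Subgroup.zpowers (r 1 : DihedralGroup n) := by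
  obtain ⟨k, rfl⟩ := ZMod.intCast_surjective i
  exact ⟨k, r_one_zpow k⟩

theorem DihedralGroup.sr_notMem_zpowers_r_one {n : ℕ} (i : ZMod n) :
    sr i ∉ Subgroup.zpowers (r 1 : DihedralGroup n) := by
  rintro ⟨k, hk⟩
  simp only [r_one_zpow, reduceCtorEq] at hk

theorem DihedralGroup.index_zpowers_r_one (n : ℕ) :
    (Subgroup.zpowers (r 1 : DihedralGroup n)).index = 2 := by
  rw [Subgroup.index_eq_two_iff]
  refine ⟨sr 0, ?_⟩
  rintro (i | i) <;>
    simp [r_mem_zpowers_r_one, sr_notMem_zpowers_r_one]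

theorem dihedralShift_r (i : ZMod 0) : dihedralShift (.r i) = .r i := rfl

theorem dihedralShift_sr (i : ZMod 0) : dihedralShift (.sr i) = .sr (i + 1) := rfl

theorem dihedralShift_zpow_r (k : ℤ) (i : ZMod 0) : (dihedralShift ^ k) (.r i) = .r i := by
  induction k generalizing i with
  | zero => rfl
  | succ k ih => rw [zpow_add_one, MulAut.mul_apply, dihedralShift_r, ih]
  | pred k ih =>
    rw [zpow_sub_one, MulAut.mul_apply, MulAut.inv_apply,
      (MulEquiv.symm_apply_eq _).2 (dihedralShift_r i).symm, ih]

theorem dihedralShift_zpow_sr (k : ℤ) (i : ZMod 0) :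
    (dihedralShift ^ k) (.sr i) = .sr (i + (Int.cast k : ZMod 0)) := by
  induction k generalizing i with
  | zero => simp
  | succ k ih =>
    rw [zpow_add_one, MulAut.mul_apply, dihedralShift_sr, ih]
    congr 1
    push_cast
    ring
  | pred k ih =>
    have h : dihedralShift (.sr (i - 1)) = .sr i := by rw [dihedralShift_sr, sub_add_cancel]
    rw [zpow_sub_one, MulAut.mul_apply, MulAut.inv_apply,
      (MulEquiv.symm_apply_eq _).2 h.symm, ih]
    congr 1
    push_cast
    ring

theorem isBoundedAut_dihedralShift_zpow (k : ℤ) : IsBoundedAut (dihedralShift ^ k) := by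
  have : (Subgroup.zpowers (DihedralGroup.r 1 : DihedralGroup 0)).FiniteIndex :=
    ⟨by rw [DihedralGroup.index_zpowers_r_one]; exact two_ne_zero⟩
  refine Subgroup.finiteIndex_of_le (H := Subgroup.zpowers (DihedralGroup.r 1)) ?_
  rw [Subgroup.zpowers_le]
  exact dihedralShift_zpow_r k 1

theorem IsBoundedAut.apply_r_one {ψ : MulAut (DihedralGroup 0)} (h : IsBoundedAut ψ) :
    ψ (.r 1) = .r 1 := by
  obtain ⟨n, hn, -, hmem⟩ := Subgroup.exists_pow_mem_of_index_ne_zero h.index_ne_zero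
    (DihedralGroup.r 1 : DihedralGroup 0)
  rw [mem_fixedSubgroup, map_pow] at hmem
  rcases hψ : ψ (.r 1) with k | k
  · rw [hψ, DihedralGroup.r_pow, DihedralGroup.r_pow, DihedralGroup.r.injEq] at hmem
    exact congrArg _ (mul_right_cancel₀ (Nat.cast_ne_zero.2 hn.ne') hmem)
  · have ho := MulEquiv.orderOf_eq ψ (DihedralGroup.r 1)
    rw [hψ, DihedralGroup.orderOf_sr, DihedralGroup.orderOf_r_one] at ho
    exact absurd ho two_ne_zero

theorem IsBoundedAut.apply_r {ψ : MulAut (DihedralGroup 0)} (h : IsBoundedAut ψ) (i : ZMod 0) :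
    ψ (.r i) = .r i := by
  have hle : Subgroup.zpowers (DihedralGroup.r 1) ≤ fixedSubgroup ψ :=
    Subgroup.zpowers_le.2 h.apply_r_one
  exact hle (DihedralGroup.r_mem_zpowers_r_one i)

theorem IsBoundedAut.mem_zpowers_dihedralShift {ψ : MulAut (DihedralGroup 0)}
    (h : IsBoundedAut ψ) : ψ ∈ Subgroup.zpowers dihedralShift := by
  rcases hψ : ψ (.sr 0) with k | k
  · have := ψ.injective (hψ.trans (h.apply_r k).symm)
    simp at this
  · obtain ⟨k, rfl⟩ := ZMod.intCast_surjective k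
    refine ⟨k, MulEquiv.ext ?_⟩
    rintro (i | i)
    · exact (dihedralShift_zpow_r k i).trans (h.apply_r i).symm
    · have hi : (DihedralGroup.sr i : DihedralGroup 0) = .sr 0 * .r i := by simp
      refine (dihedralShift_zpow_sr k i).trans ?_
      rw [hi, map_mul, hψ, h.apply_r, DihedralGroup.sr_mul_r, add_comm]

theorem not_isOfFinOrder_dihedralShift : ¬ IsOfFinOrder dihedralShift := by
  rw [isOfFinOrder_iff_zpow_eq_one]
  rintro ⟨k, hk, hpow⟩
  have h := dihedralShift_zpow_sr k 0
  rw [hpow, MulAut.one_apply, DihedralGroup.sr.injEq, zero_add] at h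
  exact hk (Int.cast_eq_zero.1 h.symm)

/-- The subgroup of bounded automorphisms of the infinite dihedral group is infinite cyclic,
generated by the automorphism `φ` with `φ(x) = xy`, `φ(y) = y`. -/
theorem bounded_auts_of_infinite_dihedral :
    {ψ : MulAut (DihedralGroup 0) | IsBoundedAut ψ} =
      (Subgroup.zpowers dihedralShift : Set (MulAut (DihedralGroup 0))) ∧
    ¬ IsOfFinOrder dihedralShift := by
  refine ⟨Set.ext fun ψ => ⟨fun h => h.mem_zpowers_dihedralShift, ?_⟩,
    not_isOfFinOrder_dihedralShift⟩
  rintro ⟨k, rfl⟩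
  exact isBoundedAut_dihedralShift_zpow k
end

section
/- Let Γ₀, Γ₁, Γ₂ be groups with injective homomorphisms i₁ : Γ₀ → Γ₁ and i₂ : Γ₀ → Γ₂ such that the image i₁(Γ₀) has index at least 3 in Γ₁ and the image i₂(Γ₀) has index at least 2 in Γ₂. Let Γ = Γ₁ *_{Γ₀} Γ₂ be the corresponding free product with amalgamation (the pushout of i₁ and i₂). Then the FC-centre K(Γ) is contained in the image of Γ₀ under the canonical (injective) map Γ₀ → Γ. -/
namespace Monoid.PushoutI

variable {ι H : Type*} {G : ι → Type*} [∀ i, Group (G i)] [Group H] {φ : ∀ i, H →* G i}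

variable (φ) in
/-- `IsReducedProd φ x i j n` says that `x` is the product of a reduced word of length `n ≥ 1`
whose first letter lies in `G i` and whose last letter lies in `G j`. -/
inductive IsReducedProd : PushoutI φ → ι → ι → ℕ → Prop
  | single {i : ι} {g : G i} (hg : g ∉ (φ i).range) : IsReducedProd (of i g) i i 1
  | cons {i j k : ι} {n : ℕ} {g : G i} {x : PushoutI φ} (hg : g ∉ (φ i).range) (hij : i ≠ j)
      (hx : IsReducedProd x j k n) : IsReducedProd (of i g * x) i k (n + 1)

namespace IsReducedProd

variable {x : PushoutI φ} {i j k l : ι} {m n : ℕ}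

theorem mul_of (hx : IsReducedProd φ x i j n) {g : G k} (hg : g ∉ (φ k).range) (hjk : j ≠ k) :
    IsReducedProd φ (x * PushoutI.of k g) i k (n + 1) := by
  induction hx with
  | single hg' => exact cons hg' hjk (single hg)
  | cons hg' hij _ ih =>
    rw [mul_assoc]
    exact cons hg' hij (ih hjk)

theorem inv (hx : IsReducedProd φ x i j n) : IsReducedProd φ x⁻¹ j i n := by
  induction hx with
  | single hg =>
    rw [← map_inv]
    exact single (by rwa [inv_mem_iff])
  | cons hg hij _ ih =>
    rw [mul_inv_rev, ← map_inv]
    exact ih.mul_of (by rwa [inv_mem_iff]) hij.symm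

theorem base_mul (hx : IsReducedProd φ x i j n) (h : H) :
    IsReducedProd φ (base φ h * x) i j n := by
  cases hx with
  | single hg =>
    rw [← of_apply_eq_base φ i, ← map_mul]
    exact single (by rwa [Subgroup.mul_mem_cancel_left _ (MonoidHom.mem_range.2 ⟨h, rfl⟩)])
  | cons hg hij hx =>
    rw [← mul_assoc, ← of_apply_eq_base φ i, ← map_mul]
    exact cons (by rwa [Subgroup.mul_mem_cancel_left _ (MonoidHom.mem_range.2 ⟨h, rfl⟩)]) hij hx

theorem exists_normalWord (hx : IsReducedProd φ x i j n) (d : NormalWord.Transversal φ) :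
    ∃ w : NormalWord d, w.prod = x ∧ w.fstIdx = some i ∧ w.toList.length = n := by
  induction hx with
  | @single i g hg =>
    exact ⟨NormalWord.cons g .empty (by simp [CoprodI.Word.fstIdx]) hg, by simp,
      by simp [CoprodI.Word.fstIdx], by simp⟩
  | @cons i j k n g x hg hij _ ih =>
    obtain ⟨w, rfl, hw, rfl⟩ := ih
    exact ⟨NormalWord.cons g w (by simpa [hw] using hij.symm) hg, by simp,
      by simp [CoprodI.Word.fstIdx], by simp⟩

theorem length_unique (hφ : ∀ i, Function.Injective (φ i)) (hm : IsReducedProd φ x i j m)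
    (hn : IsReducedProd φ x k l n) : m = n := by
  obtain ⟨d⟩ := NormalWord.transversal_nonempty φ hφ
  obtain ⟨w, hw, -, rfl⟩ := hm.exists_normalWord d
  obtain ⟨w', hw', -, rfl⟩ := hn.exists_normalWord d
  rw [NormalWord.prod_injective (hw.trans hw'.symm)]

theorem conj (hx : IsReducedProd φ x i i n) {g : G j} (hg : g ∉ (φ j).range) (hij : i ≠ j) :
    IsReducedProd φ (PushoutI.of j g * x * (PushoutI.of j g)⁻¹) j j (n + 2) := by
  rw [← map_inv]
  exact (cons hg hij.symm hx).mul_of (by rwa [inv_mem_iff]) hij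

end IsReducedProd

/-- Every element of an amalgamated product lies in the base group or is the product of a nonempty
reduced word. -/
theorem mem_range_base_or_exists_isReducedProd (hφ : ∀ i, Function.Injective (φ i))
    (x : PushoutI φ) :
    x ∈ (base φ).range ∨ ∃ i j n, IsReducedProd φ x i j n := by
  classical
  obtain ⟨d⟩ := NormalWord.transversal_nonempty φ hφ
  suffices h : ∀ w : NormalWord d, (w.toList = [] ∧ w.prod ∈ (base φ).range) ∨
      ∃ i j n, w.fstIdx = some i ∧ IsReducedProd φ w.prod i j n by
    have hw := h (NormalWord.equiv x)
    have hx : (NormalWord.equiv (d := d) x).prod = x := NormalWord.equiv.left_inv x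
    rw [hx] at hw
    exact hw.imp And.right fun ⟨i, j, n, _, hr⟩ => ⟨i, j, n, hr⟩
  intro w
  induction w using NormalWord.consRecOn with
  | empty => exact .inl ⟨rfl, by simp⟩
  | cons i g w hmw _ hgr _ ih =>
    right
    rw [NormalWord.prod_cons]
    have hfst : (NormalWord.cons g w hmw hgr).fstIdx = some i := by
      simp [CoprodI.Word.fstIdx]
    obtain ⟨-, h, hh⟩ | ⟨j, k, n, hj, hr⟩ := ih
    · refine ⟨i, i, 1, hfst, ?_⟩
      rw [← hh, ← of_apply_eq_base φ i, ← map_mul]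
      exact .single (by rwa [Subgroup.mul_mem_cancel_right _ (MonoidHom.mem_range.2 ⟨h, rfl⟩)])
    · exact ⟨i, k, n + 1, hfst, .cons hgr (by rintro rfl; exact hmw hj) hr⟩
  | base h w _ ih =>
    rw [NormalWord.prod_smul]
    obtain ⟨hl, hw⟩ | ⟨i, j, n, hi, hr⟩ := ih
    · exact .inl ⟨hl, mul_mem ⟨h, rfl⟩ hw⟩
    · exact .inr ⟨i, j, n, hi, hr.base_mul h⟩

end Monoid.PushoutI

theorem finite_range_conj_of_mem_FCCentre {Γ : Type*} [Group Γ] {γ : Γ} (hγ : γ ∈ FCCentre Γ) :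
    (Set.range fun g : Γ => g * γ * g⁻¹).Finite := by
  have : (Subgroup.centralizer {γ}).FiniteIndex := hγ
  let f : Γ ⧸ Subgroup.centralizer {γ} → Γ := Quotient.lift (fun g => g * γ * g⁻¹) <| by
    intro a b hab
    have h := Subgroup.mem_centralizer_singleton_iff.1 (QuotientGroup.leftRel_apply.1 hab)
    have h' : γ * (a⁻¹ * b) = a⁻¹ * b * γ := h.symm
    calc a * γ * a⁻¹ = a * (γ * (a⁻¹ * b)) * b⁻¹ := by group
      _ = b * γ * b⁻¹ := by rw [h']; group
  refine (Set.finite_range f).subset ?_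
  rintro _ ⟨g, rfl⟩
  exact ⟨QuotientGroup.mk g, rfl⟩

namespace Monoid.PushoutI

variable {H : Type*} {G : Bool → Type*} [∀ b, Group (G b)] [Group H] {φ : ∀ b, H →* G b}

theorem IsReducedProd.infinite_range_conj (hφ : ∀ b, Function.Injective (φ b))
    (hne : ∀ b, ∃ g : G b, g ∉ (φ b).range) {x : PushoutI φ} {i : Bool} {n : ℕ}
    (hx : IsReducedProd φ x i i n) : (Set.range fun g => g * x * g⁻¹).Infinite := by
  have key : ∀ k : ℕ, ∃ g : PushoutI φ, ∃ j, IsReducedProd φ (g * x * g⁻¹) j j (n + 2 * k) := by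
    intro k
    induction k with
    | zero => exact ⟨1, i, by simpa using hx⟩
    | succ k ih =>
      obtain ⟨g, j, hg⟩ := ih
      obtain ⟨a, ha⟩ := hne (!j)
      refine ⟨PushoutI.of (!j) a * g, !j, ?_⟩
      convert hg.conj ha (by simp) using 1
      · simp [mul_assoc]
      · omega
  choose g j hg using key
  refine Set.infinite_of_injective_forall_mem (f := fun k => g k * x * (g k)⁻¹) ?_
    fun k => ⟨g k, rfl⟩
  intro k l (hkl : g k * x * (g k)⁻¹ = g l * x * (g l)⁻¹)
  have h := hg k
  rw [hkl] at h
  have := h.length_unique hφ (hg l)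
  omega

theorem IsReducedProd.exists_conj_isReducedProd {x : PushoutI φ} {n : ℕ}
    (hG : ∀ g : G true, ∃ a : G true, a ∉ (φ true).range ∧ a⁻¹ * g ∉ (φ true).range)
    (hx : IsReducedProd φ x true false n) :
    ∃ g m, IsReducedProd φ (g * x * g⁻¹) true true m := by
  cases hx with
  | @cons _ j _ n g y hg hij hy =>
    obtain ⟨a, ha, hag⟩ := hG g
    refine ⟨(PushoutI.of true a)⁻¹, n + 2, ?_⟩
    convert (IsReducedProd.cons hag hij hy).mul_of ha (by simp) using 1
    simp [mul_assoc]

end Monoid.PushoutI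

open Monoid in
/-- Let `Γ = Γ₁ *_{Γ₀} Γ₂` be a free product with amalgamation along injective maps
`i₁ : Γ₀ → Γ₁`, `i₂ : Γ₀ → Γ₂`, where `[Γ₁ : i₁(Γ₀)] ≥ 3` and `[Γ₂ : i₂(Γ₀)] ≥ 2`.
Then the FC-centre of `Γ` is contained in the image of `Γ₀`.
(Here `Γ₁ = G true`, `Γ₂ = G false` and the pushout is `Monoid.PushoutI φ`.) -/
theorem fcCentre_le_base_of_amalgam (Γ₀ : Type*) [Group Γ₀]
    (G : Bool → Type*) [∀ b, Group (G b)] (φ : ∀ b, Γ₀ →* G b)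
    (hinj : ∀ b, Function.Injective (φ b))
    (h₁ : 3 ≤ Cardinal.mk (G true ⧸ (φ true).range))
    (h₂ : 2 ≤ Cardinal.mk (G false ⧸ (φ false).range)) :
    (FCCentre (PushoutI φ) : Set (PushoutI φ)) ⊆ Set.range (PushoutI.base φ) := by
  intro γ hγ
  have hG : ∀ g : G true, ∃ a : G true, a ∉ (φ true).range ∧ a⁻¹ * g ∉ (φ true).range := by
    intro g
    obtain ⟨q, hq₁, hqg⟩ := Cardinal.exists_ne_ne_of_three_le h₁ (QuotientGroup.mk 1)
      (QuotientGroup.mk g)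
    obtain ⟨a, rfl⟩ := QuotientGroup.mk_surjective q
    rw [Ne, QuotientGroup.eq] at hq₁ hqg
    exact ⟨a, by simpa using hq₁, hqg⟩
  have hne : ∀ b, ∃ g : G b, g ∉ (φ b).range := by
    rintro (_ | _)
    · obtain ⟨q, hq⟩ := (Cardinal.two_le_iff' (QuotientGroup.mk 1)).1 h₂
      obtain ⟨a, rfl⟩ := QuotientGroup.mk_surjective q
      rw [ne_comm, Ne, QuotientGroup.eq] at hq
      exact ⟨a, by simpa using hq⟩
    · exact (hG 1).imp fun _ => And.left
  have odd : ∀ i n, ¬ PushoutI.IsReducedProd φ γ i i n :=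
    fun i n h => h.infinite_range_conj hinj hne (finite_range_conj_of_mem_FCCentre hγ)
  have even : ∀ γ ∈ FCCentre (PushoutI φ), ∀ n, ¬ PushoutI.IsReducedProd φ γ true false n := by
    intro γ hγ n h
    obtain ⟨g, m, hm⟩ := h.exists_conj_isReducedProd hG
    refine hm.infinite_range_conj hinj hne ((finite_range_conj_of_mem_FCCentre hγ).subset ?_)
    rintro _ ⟨a, rfl⟩
    exact ⟨a * g, by group⟩
  refine (PushoutI.mem_range_base_or_exists_isReducedProd hinj γ).resolve_right ?_
  rintro ⟨i, j, n, h⟩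
  cases i <;> cases j
  · exact odd _ _ h
  · exact even γ⁻¹ (inv_mem hγ) _ h.inv
  · exact even γ hγ _ h
  · exact odd _ _ h
end

section
/- Let G be a group, A and B subgroups of G with A a proper subgroup of G (i.e., [G : A] > 1), and let φ : A → B be a group isomorphism. Let Γ = G*_A be the corresponding HNN extension ⟨G, t | t⁻¹ a t = φ(a), a ∈ A⟩. Then the centre Z(Γ) equals the image, under the canonical embedding of G in Γ, of the subgroup {a ∈ A : a ∈ Z(G) and φ(a) = a}; that is, Z(Γ) = Z(G) ∩ Fix(φ). -/
namespace HNNExtension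

variable {G : Type*} [Group G] {A B : Subgroup G} {φ : A ≃* B}

open NormalWord

/-- A reduced word containing the stable letter can be multiplied on the right by an element of
the base group without changing its head. -/
theorem NormalWord.ReducedWord.exists_prod_eq_mul_of (w : ReducedWord G A B)
    (hw : w.toList ≠ []) (g : G) :
    ∃ w' : ReducedWord G A B, w'.head = w.head ∧ w'.prod φ = w.prod φ * of g := by
  obtain ⟨h, l, chain⟩ := w
  obtain rfl | ⟨l, ⟨u, x⟩, rfl⟩ := l.eq_nil_or_concat
  · exact absurd rfl hw
  · refine ⟨⟨h, l ++ [(u, x * g)], ?_⟩, rfl, ?_⟩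
    · simpa [List.isChain_append] using chain
    · simp [ReducedWord.prod, mul_assoc]

/-- If a reduced word containing the stable letter represents a central element, then one of the
two associated subgroups is the whole group, depending on the first stable letter. -/
theorem NormalWord.ReducedWord.toSubgroup_eq_top_of_prod_mem_center (w : ReducedWord G A B)
    (hw : w.prod φ ∈ Subgroup.center (HNNExtension G A B φ)) {u : ℤˣ}
    (hu : u ∈ w.toList.head?.map Prod.fst) : toSubgroup A B (-u) = ⊤ := by
  have hne : w.toList ≠ [] := by
    intro h
    simp [h] at hu
  have key (g : G) : w.head⁻¹ * (g * w.head) ∈ toSubgroup A B (-u) := by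
    obtain ⟨w', hhead, hprod⟩ := ReducedWord.exists_prod_eq_mul_of (φ := φ) w hne g
    have heq : w'.prod φ = (⟨g * w.head, w.toList, w.chain⟩ : ReducedWord G A B).prod φ := by
      rw [hprod, ← Subgroup.mem_center_iff.1 hw (of g)]
      simp [ReducedWord.prod, mul_assoc]
    obtain ⟨hmap, hcoset⟩ := HNNExtension.ReducedWord.map_fst_eq_and_of_prod_eq φ heq
    rw [← hhead]
    have := hcoset u (by rwa [← List.head?_map, hmap, List.head?_map])
    rwa [← hhead] at this
  rw [Subgroup.eq_top_iff']
  intro x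
  simpa [mul_assoc] using key (w.head * x * w.head⁻¹)

/-- If `g` commutes with the stable letter, then `g` is a fixed point of `φ`. -/
theorem exists_mem_map_eq_of_commute_t {g : G}
    (hg : Commute (t : HNNExtension G A B φ) (of g)) :
    ∃ h : g ∈ A, ((φ ⟨g, h⟩ : B) : G) = g := by
  have hA : g ∈ A := by
    by_contra hgA
    let w : ReducedWord G A B := ⟨1, [(1, g), (-1, 1)], by simp [hgA]⟩
    have hw : w.prod φ = of g := by simp [w, ReducedWord.prod, hg.eq]
    simpa [w] using HNNExtension.ReducedWord.toList_eq_nil_of_mem_of_range φ w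
      (hw ▸ ⟨g, rfl⟩)
  refine ⟨hA, of_injective (φ := φ) ?_⟩
  rw [equiv_eq_conj, hg.eq, mul_inv_cancel_right]

section Ascending

theorem inv_t_mul_of_of_eq_top (hB : B = ⊤) (g : G) :
    ∃ a ∈ A, (t : HNNExtension G A B φ)⁻¹ * of g = of a * t⁻¹ :=
  ⟨_, (φ.symm ⟨g, hB ▸ Subgroup.mem_top g⟩).2, inv_t_mul_of (⟨g, hB ▸ Subgroup.mem_top g⟩ : B)⟩

theorem inv_t_pow_succ_mul_of_of_eq_top (hB : B = ⊤) (n : ℕ) (g : G) :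
    ∃ a ∈ A, (t : HNNExtension G A B φ)⁻¹ ^ (n + 1) * of g = of a * t⁻¹ ^ (n + 1) := by
  induction n generalizing g with
  | zero => simpa using inv_t_mul_of_of_eq_top hB g
  | succ n ih =>
    obtain ⟨a, -, ha⟩ := inv_t_mul_of_of_eq_top (φ := φ) hB g
    obtain ⟨b, hb, hab⟩ := ih a
    refine ⟨b, hb, ?_⟩
    rw [pow_succ, mul_assoc, ha, ← mul_assoc, hab, mul_assoc]

theorem of_mul_t_pow_of_eq_top (hB : B = ⊤) (n : ℕ) (g : G) :
    ∃ a, of g * (t : HNNExtension G A B φ) ^ n = t ^ n * of a := by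
  cases n with
  | zero => exact ⟨g, by simp⟩
  | succ n =>
    obtain ⟨a, -, ha⟩ := inv_t_pow_succ_mul_of_of_eq_top (φ := φ) hB n g
    refine ⟨a, ?_⟩
    rwa [inv_pow, inv_mul_eq_iff_eq_mul, ← mul_assoc, eq_mul_inv_iff_mul_eq] at ha

/-- In an ascending HNN extension every element has the form `t ^ i * g * t ^ (-j)`. -/
theorem exists_eq_t_pow_mul_of_mul_inv_t_pow (hB : B = ⊤) (x : HNNExtension G A B φ) :
    ∃ (i j : ℕ) (g : G), x = t ^ i * of g * t⁻¹ ^ j := by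
  obtain ⟨d⟩ := TransversalPair.nonempty G A B
  obtain ⟨w, rfl⟩ := (NormalWord.equiv φ d).symm.surjective x
  change ∃ (i j : ℕ) (g : G), w.prod φ = t ^ i * of g * t⁻¹ ^ j
  induction w using consRecOn with
  | ofGroup g => exact ⟨0, 0, g, by simp [ReducedWord.prod]⟩
  | cons h u w h1 h2 ih =>
    obtain ⟨i, j, g, hw⟩ := ih
    suffices ∃ (i j : ℕ) (g : G),
        (t : HNNExtension G A B φ) ^ (u : ℤ) * w.prod φ = t ^ i * of g * t⁻¹ ^ j by
      obtain ⟨i, j, g, hx⟩ := this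
      obtain ⟨a, ha⟩ := of_mul_t_pow_of_eq_top (φ := φ) hB i h
      refine ⟨i, j, a * g, ?_⟩
      rw [prod_cons, hx, ← mul_assoc, ← mul_assoc, ha, map_mul, mul_assoc (t ^ i)]
    rw [hw]
    obtain rfl | rfl := Int.units_eq_one_or u
    · exact ⟨i + 1, j, g, by simp [pow_succ', mul_assoc]⟩
    · cases i with
      | zero =>
        obtain ⟨a, -, ha⟩ := inv_t_mul_of_of_eq_top (φ := φ) hB g
        refine ⟨0, j + 1, a, ?_⟩
        simp only [Units.val_neg, Units.val_one, zpow_neg, zpow_one, pow_zero, one_mul]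
        rw [← mul_assoc, ha, mul_assoc, ← pow_succ']
      | succ i => exact ⟨i, j, g, by simp [pow_succ', mul_assoc]⟩

theorem eq_top_of_inv_t_pow_eq (hB : B = ⊤) {n : ℕ} {c : HNNExtension G A B φ}
    (hc : c ∈ Subgroup.center (HNNExtension G A B φ)) {g : G} (h : t⁻¹ ^ (n + 1) = of g * c) :
    A = ⊤ := by
  rw [Subgroup.eq_top_iff']
  intro x
  obtain ⟨a, ha, hax⟩ := inv_t_pow_succ_mul_of_of_eq_top (φ := φ) hB n (g⁻¹ * x * g)
  rw [h, mul_assoc, ← Subgroup.mem_center_iff.1 hc, ← mul_assoc, ← mul_assoc,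
    mul_left_inj, ← map_mul, ← map_mul] at hax
  have := of_injective (φ := φ) hax
  rw [mul_assoc, mul_inv_cancel_left, mul_left_inj] at this
  exact this ▸ ha

end Ascending

/-- If `A` is a proper subgroup, then every central element of the HNN extension lies in the
base group. -/
theorem mem_range_of_mem_center (hA : A ≠ ⊤) {z : HNNExtension G A B φ}
    (hz : z ∈ Subgroup.center (HNNExtension G A B φ)) : ∃ g, of g = z := by
  by_cases hB : B = ⊤
  · obtain ⟨i, j, g, rfl⟩ := exists_eq_t_pow_mul_of_mul_inv_t_pow hB z
    have hcomm := Subgroup.mem_center_iff.1 hz (t ^ i)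
    rw [mul_assoc (t ^ i), mul_assoc (t ^ i), mul_right_inj] at hcomm
    rw [mul_assoc (t ^ i), hcomm] at hz ⊢
    obtain h | rfl | h := lt_trichotomy i j
    · obtain ⟨k, rfl⟩ := Nat.exists_eq_add_of_lt h
      refine absurd (eq_top_of_inv_t_pow_eq hB (n := k) (g := g⁻¹) hz ?_) hA
      rw [map_inv]
      group
    · exact ⟨g, by simp⟩
    · obtain ⟨k, rfl⟩ := Nat.exists_eq_add_of_lt h
      refine absurd (eq_top_of_inv_t_pow_eq hB (n := k) (g := g) (inv_mem hz) ?_) hA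
      rw [Subgroup.mem_center_iff.1 (inv_mem hz)]
      group
  · obtain ⟨d⟩ := TransversalPair.nonempty G A B
    obtain ⟨w, rfl⟩ := (NormalWord.equiv φ d).symm.surjective z
    change w.prod φ ∈ _ at hz
    cases hl : w.toList with
    | nil => exact ⟨w.head, by simp [NormalWord.equiv, ReducedWord.prod, hl]⟩
    | cons p l =>
      have htop := ReducedWord.toSubgroup_eq_top_of_prod_mem_center w.toReducedWord hz
        (u := p.1) (by simp [hl])
      obtain hp | hp := Int.units_eq_one_or p.1
      · exact absurd (by simpa [hp] using htop) hB
      · exact absurd (by simpa [hp] using htop) hA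

end HNNExtension

/-- Let `Γ = G*_A = ⟨G, t | t⁻¹ a t = φ(a), a ∈ A⟩` be the HNN extension over an
isomorphism `φ : A ≃* B` of subgroups of `G`, with `A` a proper subgroup of `G`.
Then `Z(Γ) = Z(G) ∩ Fix(φ)`, i.e. the centre of `Γ` is the image under the canonical
embedding `G → Γ` of `{a ∈ A : a ∈ Z(G), φ(a) = a}`. -/
theorem center_of_hnnExtension (G : Type*) [Group G] (A B : Subgroup G) (φ : A ≃* B)
    (hA : A ≠ ⊤) :
    (Subgroup.center (HNNExtension G A B φ) : Set (HNNExtension G A B φ)) =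
      HNNExtension.of ''
        {g : G | g ∈ Subgroup.center G ∧ ∃ h : g ∈ A, ((φ ⟨g, h⟩ : B) : G) = g} := by
  ext z
  constructor
  · intro hz
    obtain ⟨g, rfl⟩ := HNNExtension.mem_range_of_mem_center hA hz
    have hcomm := Subgroup.mem_center_iff.1 hz
    refine ⟨g, ⟨Subgroup.mem_center_iff.2 fun x => ?_, ?_⟩, rfl⟩
    · exact HNNExtension.of_injective (φ := φ) (by simpa using hcomm (HNNExtension.of x))
    · exact HNNExtension.exists_mem_map_eq_of_commute_t (hcomm HNNExtension.t)
  · rintro ⟨g, ⟨hg, hgA, hfix⟩, rfl⟩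
    refine Subgroup.mem_center_iff.2 fun x => ?_
    change Commute x (HNNExtension.of g)
    induction x using HNNExtension.induction_on with
    | of x => exact Commute.map (Subgroup.mem_center_iff.1 hg x) HNNExtension.of
    | t => simpa [hfix, commute_iff_eq] using HNNExtension.t_mul_of (φ := φ) ⟨g, hgA⟩
    | mul x y hx hy => exact hx.mul_left hy
    | inv x hx => exact hx.inv_left
end

section
/- Let G be a group, A and B subgroups of G with A a proper subgroup of G (i.e., [G : A] > 1), and let φ : A → B be a group isomorphism with HNN extension Γ = ⟨G, t | t⁻¹ a t = φ(a), a ∈ A⟩. Define A_1 = A, A_k = {a ∈ A : φ(a) ∈ A_{k-1}} for k ≥ 2, F_k = {a ∈ A_k : φ^k(a) = a}, and F_∞ = ⋃_{k ≥ 1} F_k. Then the FC-centre K(Γ) is contained in the image, under the canonical embedding of G in Γ, of K(G) ∩ F_∞. -/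
/-- The partial map `G → G` induced by the partial isomorphism `φ : A ≃* B`
(with junk value `1` off `A`). -/
noncomputable def partialIter {G : Type*} [Group G] {A B : Subgroup G} (φ : A ≃* B) (g : G) : G :=
  letI := Classical.dec (g ∈ A)
  if h : g ∈ A then ((φ ⟨g, h⟩ : B) : G) else 1

/-- `domainIter φ k` is the set `A_k` of elements on which the `k`-fold iterate `φ^k` is
defined: `A_1 = A` and `A_k = {a ∈ A : φ(a) ∈ A_{k-1}}` for `k ≥ 2`. -/
def domainIter {G : Type*} [Group G] {A B : Subgroup G} (φ : A ≃* B) (k : ℕ) : Set G :=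
  {a | ∀ j < k, (partialIter φ)^[j] a ∈ A}

/-- `fixIter φ k` is the set `F_k = {a ∈ A_k : φ^k(a) = a}`. -/
def fixIter {G : Type*} [Group G] {A B : Subgroup G} (φ : A ≃* B) (k : ℕ) : Set G :=
  {a | a ∈ domainIter φ k ∧ (partialIter φ)^[k] a = a}

namespace HNNExtension

open NormalWord

variable {G : Type*} [Group G] {A B : Subgroup G} {φ : A ≃* B}

namespace NormalWord.ReducedWord

/-- A reduced word `w` such that conjugating it by the stable letter, `t * w * t⁻¹`, involves no
cancellation at either end. -/
def ConjReduced (w : ReducedWord G A B) : Prop :=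
  ((1, w.head) :: w.toList).IsChain (fun a b => a.2 ∈ toSubgroup A B a.1 → a.1 = b.1) ∧
    ∀ x ∈ ((1, w.head) :: w.toList).getLast?, x.2 ∈ toSubgroup A B x.1 → x.1 = -1

theorem ConjReduced.exists_conj_t {w : ReducedWord G A B} (hw : w.ConjReduced) :
    ∃ w' : ReducedWord G A B, w'.ConjReduced ∧ w'.toList.length = w.toList.length + 2 ∧
      w'.prod φ = t * w.prod φ * t⁻¹ := by
  obtain ⟨hchain, hlast⟩ := hw
  have hchain' : (((1, w.head) :: w.toList) ++ [((-1 : ℤˣ), (1 : G))]).IsChain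
      (fun a b => a.2 ∈ toSubgroup A B a.1 → a.1 = b.1) := by
    refine List.isChain_append.2 ⟨hchain, by simp, ?_⟩
    intro x hx y hy hmem
    simp only [List.head?_cons, Option.mem_def, Option.some.injEq] at hy
    rw [← hy]
    exact hlast x hx hmem
  refine ⟨⟨1, ((1, w.head) :: w.toList) ++ [(-1, 1)], hchain'⟩, ⟨?_, ?_⟩, ?_, ?_⟩
  · refine List.isChain_cons.2 ⟨?_, hchain'⟩
    simp
  · intro x hx
    rw [← List.cons_append, List.getLast?_append] at hx
    simp only [List.getLast?_singleton, Option.some_or, Option.mem_def, Option.some.injEq] at hx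
    rw [← hx]
    simp
  · simp
  · simp [prod, mul_assoc]

theorem ConjReduced.exists_conj_t_pow {w : ReducedWord G A B} (hw : w.ConjReduced) (k : ℕ) :
    ∃ w' : ReducedWord G A B, w'.toList.length = w.toList.length + 2 * k ∧
      w'.prod φ = t ^ k * w.prod φ * (t ^ k)⁻¹ := by
  suffices ∃ w' : ReducedWord G A B, w'.ConjReduced ∧
      w'.toList.length = w.toList.length + 2 * k ∧
      w'.prod φ = t ^ k * w.prod φ * (t ^ k)⁻¹ by
    obtain ⟨w', -, h⟩ := this
    exact ⟨w', h⟩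
  induction k with
  | zero => exact ⟨w, hw, by simp⟩
  | succ k ih =>
    obtain ⟨w₁, hw₁, hlen₁, hprod₁⟩ := ih
    obtain ⟨w₂, hw₂, hlen₂, hprod₂⟩ := hw₁.exists_conj_t (φ := φ)
    refine ⟨w₂, hw₂, by omega, ?_⟩
    rw [hprod₂, hprod₁, pow_succ']
    group

theorem exists_prod_mul_of (w : ReducedWord G A B) (g : G) :
    ∃ w' : ReducedWord G A B, w'.toList.length = w.toList.length ∧
      w'.prod φ = w.prod φ * of g := by
  obtain ⟨h, l, hl⟩ := w
  rcases List.eq_nil_or_concat' l with rfl | ⟨l', x, rfl⟩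
  · exact ⟨⟨h * g, [], List.isChain_nil⟩, rfl, by simp [prod]⟩
  · refine ⟨⟨h, l' ++ [(x.1, x.2 * g)], ?_⟩, by simp, by simp [prod, mul_assoc]⟩
    rw [List.isChain_append] at hl ⊢
    refine ⟨hl.1, by simp, ?_⟩
    simpa using hl.2.2

/-- A nontrivial reduced word either is reduced with respect to conjugation by `t`, or can be
shortened by multiplying by `t` on the left or by `t⁻¹` on the right. -/
theorem conjReduced_or_exists_shorter (w : ReducedWord G A B) (hne : w.toList ≠ []) :
    w.ConjReduced ∨ ∃ w' : ReducedWord G A B, w'.toList.length < w.toList.length ∧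
      (w'.prod φ = t * w.prod φ ∨ w'.prod φ = w.prod φ * t⁻¹) := by
  rw [or_iff_not_imp_right]
  intro hmin
  obtain ⟨h, l, hl⟩ := w
  refine ⟨List.isChain_cons.2 ⟨?_, hl⟩, ?_⟩
  · rintro ⟨u, g⟩ hy hmem
    by_contra hu
    obtain rfl : u = -1 := (Int.units_eq_one_or u).resolve_left (Ne.symm hu)
    obtain ⟨l', rfl⟩ : ∃ l', l = (-1, g) :: l' := by
      cases l <;> simp_all
    refine hmin ⟨⟨φ ⟨h, hmem⟩ * g, l', (List.isChain_cons.1 hl).2⟩, by simp, Or.inl ?_⟩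
    have := t_mul_of (φ := φ) ⟨h, hmem⟩
    simp only at this
    simp [prod, ← mul_assoc, this]
  · rintro ⟨u, g⟩ hx hmem
    by_contra hu
    obtain rfl : u = 1 := (Int.units_eq_one_or u).resolve_right hu
    obtain ⟨l', rfl⟩ : ∃ l', l = l' ++ [(1, g)] := by
      rcases List.eq_nil_or_concat' l with rfl | ⟨l', x, rfl⟩
      · simp at hne
      · rw [← List.cons_append, List.getLast?_append] at hx
        simp only [List.getLast?_singleton, Option.some_or, Option.mem_def,
          Option.some.injEq] at hx
        exact ⟨l', by rw [hx]⟩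
    obtain ⟨w', hlen, hprod⟩ := exists_prod_mul_of (φ := φ)
      ⟨h, l', (List.isChain_append.1 hl).1⟩ (φ ⟨g, hmem⟩)
    refine hmin ⟨w', by simp at hlen; simp [hlen], Or.inr ?_⟩
    have := t_mul_of (φ := φ) ⟨g, hmem⟩
    simp only at this
    rw [hprod]
    simp [prod, mul_assoc, this]

theorem exists_prod_eq (γ : HNNExtension G A B φ) : ∃ w : ReducedWord G A B, w.prod φ = γ := by
  obtain ⟨d⟩ := TransversalPair.nonempty G A B
  exact ⟨(γ • (NormalWord.empty : NormalWord d)).toReducedWord, by simp⟩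

end NormalWord.ReducedWord

open NormalWord.ReducedWord

theorem mem_of_conj_t_pow_mem_range {g : G} {j : ℕ} (hj : 0 < j)
    (h : t ^ j * of g * (t ^ j)⁻¹ ∈ (of.range : Subgroup (HNNExtension G A B φ))) : g ∈ A := by
  by_contra hg
  let w : ReducedWord G A B := ⟨g, [], List.isChain_nil⟩
  have hw : w.ConjReduced := ⟨by simp [w], by simp [w, hg]⟩
  obtain ⟨w', hlen, hprod⟩ := hw.exists_conj_t_pow (φ := φ) j
  have hwp : w.prod φ = of g := by simp [w, ReducedWord.prod]
  rw [hwp] at hprod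
  rw [← hprod] at h
  have := ReducedWord.toList_eq_nil_of_mem_of_range φ w' h
  simp [this] at hlen
  omega

theorem of_partialIter {g : G} (hg : g ∈ A) :
    (of (partialIter φ g) : HNNExtension G A B φ) = t * of g * t⁻¹ := by
  simpa [partialIter, hg] using equiv_eq_conj (φ := φ) ⟨g, hg⟩

theorem of_iterate_partialIter {g : G} {j : ℕ}
    (h : t ^ j * of g * (t ^ j)⁻¹ ∈ (of.range : Subgroup (HNNExtension G A B φ))) {i : ℕ}
    (hi : i ≤ j) :
    (of ((partialIter φ)^[i] g) : HNNExtension G A B φ) = t ^ i * of g * (t ^ i)⁻¹ ∧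
      (i < j → (partialIter φ)^[i] g ∈ A) := by
  have key : ∀ i, i < j →
      (of ((partialIter φ)^[i] g) : HNNExtension G A B φ) = t ^ i * of g * (t ^ i)⁻¹ →
      (partialIter φ)^[i] g ∈ A := by
    intro i hi heq
    refine mem_of_conj_t_pow_mem_range (φ := φ) (j := j - i) (by omega) ?_
    obtain ⟨m, rfl⟩ := Nat.exists_eq_add_of_le hi.le
    rw [heq]
    convert h using 1
    rw [Nat.add_sub_cancel_left, add_comm i m, pow_add]
    group
  suffices heq : (of ((partialIter φ)^[i] g) : HNNExtension G A B φ) =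
      t ^ i * of g * (t ^ i)⁻¹ from ⟨heq, fun hlt => key i hlt heq⟩
  induction i with
  | zero => simp
  | succ i ih =>
    have ih := ih (by omega)
    rw [Function.iterate_succ_apply', of_partialIter (key i (by omega) ih), ih, pow_succ']
    group

/-- The homomorphism from an HNN extension to `ℤ` that kills the base group and sends the stable
letter to `1`. -/
def exponentSum (φ : A ≃* B) : HNNExtension G A B φ →* Multiplicative ℤ :=
  lift 1 (Multiplicative.ofAdd 1) (by simp)

@[simp]
theorem exponentSum_of (g : G) : exponentSum φ (of g) = 1 := by simp [exponentSum]

@[simp]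
theorem exponentSum_t : exponentSum φ t = Multiplicative.ofAdd 1 := by simp [exponentSum]

theorem mem_range_of_commute_t_pow {δ : HNNExtension G A B φ} {k : ℕ} (hk : 0 < k)
    (hcomm : Commute δ (t ^ k)) (hexp : exponentSum φ δ = 1) :
    δ ∈ (of.range : Subgroup (HNNExtension G A B φ)) := by
  classical
  let P : ℕ → Prop := fun n => ∃ a b : ℕ, ∃ w : ReducedWord G A B,
    w.prod φ = t ^ a * δ * (t ^ b)⁻¹ ∧ w.toList.length = n
  have hP : ∃ n, P n := by
    obtain ⟨w, hw⟩ := exists_prod_eq δ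
    exact ⟨_, 0, 0, w, by simpa using hw, rfl⟩
  obtain ⟨a, b, w, hprod, hlen⟩ := Nat.find_spec hP
  have hmin : ∀ {n}, n < Nat.find hP → ¬ P n := fun h => Nat.find_min hP h
  have hcomm' : Commute (w.prod φ) (t ^ k) := by
    have ht : ∀ m : ℕ, Commute ((t : HNNExtension G A B φ) ^ m) (t ^ k) := fun m =>
      (Commute.refl t).pow_pow m k
    rw [hprod]
    exact ((ht a).mul_left hcomm).mul_left (ht b).inv_left
  have hconj : t ^ k * w.prod φ * (t ^ k)⁻¹ = w.prod φ := by
    rw [← hcomm'.eq]; group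
  by_cases hnil : w.toList = []
  · have hwg : w.prod φ = of w.head := by simp [ReducedWord.prod, hnil]
    have hab : a = b := by
      have := congrArg (exponentSum φ) hprod
      rw [hwg] at this
      simp only [exponentSum_of, map_mul, map_inv, map_pow, exponentSum_t, hexp, mul_one] at this
      rw [eq_comm, mul_inv_eq_one] at this
      simpa [← ofAdd_nsmul] using this
    subst hab
    have hka : Commute (of w.head) ((t : HNNExtension G A B φ) ^ (k * a)) := by
      rw [← hwg, pow_mul]
      exact hcomm'.pow_right a
    have hfix : t ^ (k * a) * of w.head * (t ^ (k * a))⁻¹ =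
        (of w.head : HNNExtension G A B φ) := by
      rw [← hka.eq]; group
    have hle : a ≤ k * a := Nat.le_mul_of_pos_left a hk
    have := (of_iterate_partialIter (φ := φ) (g := w.head) (j := k * a) (i := k * a - a)
      ⟨w.head, hfix.symm⟩ (Nat.sub_le _ _)).1
    refine ⟨_, this.trans ?_⟩
    have hδ : δ = (t ^ a)⁻¹ * of w.head * t ^ a := by
      rw [← hwg, hprod]; group
    have hsplit : (t : HNNExtension G A B φ) ^ (k * a - a) = (t ^ a)⁻¹ * t ^ (k * a) := by
      rw [eq_inv_mul_iff_mul_eq, ← pow_add, Nat.add_sub_cancel' hle]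
    rw [hδ, hsplit, mul_inv_rev, inv_inv]
    conv_rhs => rw [← hfix]
    group
  · exfalso
    rcases w.conjReduced_or_exists_shorter (φ := φ) hnil with hw | ⟨w', hlt, hw' | hw'⟩
    · obtain ⟨w', hlen', hprod'⟩ := hw.exists_conj_t_pow (φ := φ) k
      have := congrArg List.length
        (ReducedWord.map_fst_eq_and_of_prod_eq φ (hprod'.trans hconj)).1
      simp only [List.length_map] at this
      omega
    · refine hmin (hlen ▸ hlt) ⟨a + 1, b, w', ?_, rfl⟩
      rw [hw', hprod, pow_succ']
      group
    · refine hmin (hlen ▸ hlt) ⟨a, b + 1, w', ?_, rfl⟩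
      rw [hw', hprod, pow_succ']
      group

end HNNExtension

theorem exists_pow_commute_of_mem_FCCentre {Γ : Type*} [Group Γ] {γ : Γ} (hγ : γ ∈ FCCentre Γ)
    (x : Γ) : ∃ k : ℕ, 0 < k ∧ Commute γ (x ^ k) := by
  obtain ⟨k, hk, -, hmem⟩ := Subgroup.exists_pow_mem_of_index_ne_zero
    ((mem_FCCentre_iff γ).1 hγ).index_ne_zero x
  exact ⟨k, hk, Subgroup.mem_centralizer_iff.1 hmem γ rfl⟩

theorem mem_FCCentre_of_map_mem {G Γ : Type*} [Group G] [Group Γ] {f : G →* Γ}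
    (hf : Function.Injective f) {g : G} (hg : f g ∈ FCCentre Γ) : g ∈ FCCentre G := by
  rw [mem_FCCentre_iff] at hg ⊢
  have : Subgroup.centralizer {g} = (Subgroup.centralizer {f g}).comap f := by
    ext x
    simp [Subgroup.mem_centralizer_iff, ← map_mul, hf.eq_iff]
  rw [this]
  refine ⟨?_⟩
  rw [Subgroup.index_comap, Subgroup.relIndex]
  exact Subgroup.FiniteIndex.index_ne_zero

namespace HNNExtension

variable {G : Type*} [Group G] {A B : Subgroup G} {φ : A ≃* B}

theorem mul_inv_t_pow_mem_range {γ : HNNExtension G A B φ} {k n : ℕ} (hk : 0 < k)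
    (hcomm : Commute γ (t ^ k)) (hexp : exponentSum φ γ = Multiplicative.ofAdd (n : ℤ)) :
    γ * (t ^ n)⁻¹ ∈ (of.range : Subgroup (HNNExtension G A B φ)) := by
  refine mem_range_of_commute_t_pow hk
    (hcomm.mul_left ((Commute.refl t).pow_pow n k).inv_left) ?_
  simp [hexp, ← ofAdd_nsmul]

theorem eq_zero_of_mem_FCCentre (hA : A ≠ ⊤) {γ : HNNExtension G A B φ}
    (hγ : γ ∈ FCCentre (HNNExtension G A B φ)) {n : ℕ}
    (hexp : exponentSum φ γ = Multiplicative.ofAdd (n : ℤ)) : n = 0 := by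
  by_contra hn
  obtain ⟨h, hh⟩ : ∃ h, h ∉ A := by
    by_contra! hall
    exact hA ((Subgroup.eq_top_iff' A).2 hall)
  obtain ⟨k, hk, hcomm⟩ := exists_pow_commute_of_mem_FCCentre hγ t
  obtain ⟨k', hk', hcomm'⟩ := exists_pow_commute_of_mem_FCCentre hγ (of h * t * (of h)⁻¹)
  have h₁ := mul_inv_t_pow_mem_range hk hcomm hexp
  have h₂ : (of h)⁻¹ * γ * of h * (t ^ n)⁻¹ ∈
      (of.range : Subgroup (HNNExtension G A B φ)) := by
    refine mul_inv_t_pow_mem_range hk' ?_ (by simp [hexp])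
    rw [conj_pow] at hcomm'
    have := hcomm'.eq
    calc (of h)⁻¹ * γ * of h * t ^ k' = (of h)⁻¹ * (γ * (of h * t ^ k' * (of h)⁻¹)) * of h := by
          group
      _ = (of h)⁻¹ * (of h * t ^ k' * (of h)⁻¹ * γ) * of h := by rw [this]
      _ = _ := by group
  refine hh (mem_of_conj_t_pow_mem_range (φ := φ) (Nat.pos_of_ne_zero hn) ?_)
  have := mul_mem (mul_mem (inv_mem h₁) (MonoidHom.mem_range.2 ⟨h, rfl⟩)) h₂
  convert this using 1
  group

end HNNExtension

/-- In the HNN extension `Γ = ⟨G, t | t⁻¹ a t = φ(a), a ∈ A⟩` with `A` a proper subgroup of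
`G`, the FC-centre of `Γ` is contained in the image under `G → Γ` of
`K(G) ∩ F_∞`, where `F_∞ = ⋃_{k ≥ 1} F_k`. -/
theorem fcCentre_hnnExtension_subset (G : Type*) [Group G] (A B : Subgroup G)
    (φ : A ≃* B) (hA : A ≠ ⊤) :
    (FCCentre (HNNExtension G A B φ) : Set (HNNExtension G A B φ)) ⊆
      HNNExtension.of '' ((FCCentre G : Set G) ∩ ⋃ k ∈ Set.Ici 1, fixIter φ k) := by
  intro γ hγ
  have hexp : HNNExtension.exponentSum φ γ = 1 := by
    obtain ⟨n, hn | hn⟩ := Int.eq_nat_or_neg (HNNExtension.exponentSum φ γ).toAdd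
    · have hn' := (ofAdd_toAdd _).symm.trans (congrArg Multiplicative.ofAdd hn)
      rw [hn', HNNExtension.eq_zero_of_mem_FCCentre hA hγ hn']
      simp
    · have hn' := (ofAdd_toAdd _).symm.trans (congrArg Multiplicative.ofAdd hn)
      rw [hn', HNNExtension.eq_zero_of_mem_FCCentre hA (inv_mem hγ) (n := n) (by simp [hn'])]
      simp
  obtain ⟨k, hk, hcomm⟩ := exists_pow_commute_of_mem_FCCentre hγ HNNExtension.t
  obtain ⟨g, rfl⟩ := HNNExtension.mem_range_of_commute_t_pow hk hcomm hexp
  refine ⟨g, ⟨mem_FCCentre_of_map_mem (HNNExtension.of_injective φ) hγ,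
    Set.mem_biUnion (Set.mem_Ici.2 hk) ?_⟩, rfl⟩
  have hfix : HNNExtension.t ^ k * HNNExtension.of g * (HNNExtension.t ^ k)⁻¹ =
      (HNNExtension.of g : HNNExtension G A B φ) := by
    rw [← hcomm.eq, mul_inv_cancel_right]
  have hiter := fun {i : ℕ} =>
    HNNExtension.of_iterate_partialIter (φ := φ) (i := i) ⟨g, hfix.symm⟩
  exact ⟨fun j hj => (hiter hj.le).2 hj,
    HNNExtension.of_injective φ ((hiter le_rfl).1.trans hfix)⟩
end
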